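/- arXiv:1803.04059 — 2 statements merged into one kernel-verified Lean document; each statement's English description precedes it below -/
import Mathlib

section
/- (Key computation in the proof of Theorem 2) Let K ≥ 1, M ≥ 1 and 1 ≤ b ≤ M be integers, let α ∈ [0,1] be real, and set ψ = min{K,b}, L' = C(K,ψ)·C(M,b), T₁ = C(K,ψ)·C(M,b+1), L̃ = C(M,b+1)·C(K−1,ψ−1)·α, and T₂ = K·(L' − L̃)/(1 + min{K−1,b}·α). Then (T₁ + T₂)/L' = ( K + δ_MAN(b/M)·(1 − 1_{K≤b}·α) ) / ( 1 + min{K−1,b}·α ), where δ_MAN(μ) = M(1−μ)/(1+μM) and 1_{K≤b} equals 1 if K ≤ b and 0 otherwise. -/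
/-- The MAN NDT `δ_MAN(μ) = M(1-μ)/(1+μM)`. -/
noncomputable def deltaMAN (M : ℕ) (μ : ℝ) : ℝ := (M : ℝ) * (1 - μ) / (1 + μ * M)

/-- The achievable one-shot NDT
`δ_OS(μ,α) = max{δ_MAN(μ), (K + δ_MAN(μ)(1 - 1_{K≤μM} α)) / (1 + min{K-1, μM} α)}`. -/
noncomputable def deltaOS (K M : ℕ) (μ α : ℝ) : ℝ :=
  max (deltaMAN M μ)
    (((K : ℝ) + deltaMAN M μ * (1 - (if (K : ℝ) ≤ μ * M then (1 : ℝ) else 0) * α)) /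
      (1 + min ((K : ℝ) - 1) (μ * (M : ℝ)) * α))

/-- Key computation in the proof of Theorem 2: with `ψ = min{K,b}`,
`L' = C(K,ψ)C(M,b)`, `T₁ = C(K,ψ)C(M,b+1)`, `L̃ = C(M,b+1)C(K-1,ψ-1)α` and
`T₂ = K(L' - L̃)/(1 + min{K-1,b}α)`, one has
`(T₁+T₂)/L' = (K + δ_MAN(b/M)(1 - 1_{K≤b} α))/(1 + min{K-1,b}α)`. -/
theorem stmt13 (K M b : ℕ) (hK : 1 ≤ K) (hM : 1 ≤ M) (hb1 : 1 ≤ b) (hbM : b ≤ M)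
    (α : ℝ) (hα0 : 0 ≤ α) (hα1 : α ≤ 1)
    (ψ : ℕ) (hψ : ψ = min K b)
    (L' T₁ Lt T₂ : ℝ)
    (hL' : L' = (K.choose ψ : ℝ) * (M.choose b : ℝ))
    (hT₁ : T₁ = (K.choose ψ : ℝ) * (M.choose (b + 1) : ℝ))
    (hLt : Lt = (M.choose (b + 1) : ℝ) * ((K - 1).choose (ψ - 1) : ℝ) * α)
    (hT₂ : T₂ = (K : ℝ) * (L' - Lt) / (1 + min ((K : ℝ) - 1) (b : ℝ) * α)) :
    (T₁ + T₂) / L' =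
      ((K : ℝ) + deltaMAN M ((b : ℝ) / M) * (1 - (if K ≤ b then (1 : ℝ) else 0) * α)) /
        (1 + min ((K : ℝ) - 1) (b : ℝ) * α) := by 
  have hMR : (0:ℝ) < M := by exact_mod_cast hM
  have hKR : (1:ℝ) ≤ K := by exact_mod_cast hK
  have hbR : (1:ℝ) ≤ b := by exact_mod_cast hb1
  have hψK : ψ ≤ K := by omega
  have hψ1 : 1 ≤ ψ := by omega
  have hA : (0:ℝ) < (K.choose ψ : ℝ) := by exact_mod_cast Nat.choose_pos hψK
  have hB : (0:ℝ) < (M.choose b : ℝ) := by exact_mod_cast Nat.choose_pos hbM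
  have hd : deltaMAN M ((b : ℝ) / M) = ((M : ℝ) - b) / (1 + b) := by
    unfold deltaMAN
    field_simp
  have hC : (M.choose (b + 1) : ℝ) = ((M : ℝ) - b) / (1 + b) * (M.choose b : ℝ) := by
    have h := Nat.choose_succ_right_eq M b
    have h2 : (M.choose (b + 1) : ℝ) * (b + 1) = (M.choose b : ℝ) * ((M : ℝ) - b) := by
      rw [← Nat.cast_sub hbM]
      exact_mod_cast h
    field_simp
    linarith
  have hE : (K : ℝ) * ((K - 1).choose (ψ - 1) : ℝ) = (K.choose ψ : ℝ) * ψ := by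
    have h := Nat.add_one_mul_choose_eq (K - 1) (ψ - 1)
    rw [Nat.sub_add_cancel hK, Nat.sub_add_cancel hψ1] at h
    exact_mod_cast h
  have hm : min ((K : ℝ) - 1) (b : ℝ) = (ψ : ℝ) - (if K ≤ b then (1 : ℝ) else 0) := by
    split_ifs with h
    · have h' : (K : ℝ) ≤ b := by exact_mod_cast h
      rw [min_eq_left (by linarith), hψ, min_eq_left h]
    · have h' : (b : ℝ) + 1 ≤ K := by exact_mod_cast (by omega : b + 1 ≤ K)
      rw [min_eq_right (by linarith), hψ, min_eq_right (by omega), sub_zero]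
  have hD : 0 < 1 + min ((K : ℝ) - 1) (b : ℝ) * α := by
    have : 0 ≤ min ((K : ℝ) - 1) (b : ℝ) := le_min (by linarith) (by linarith)
    positivity
  rw [hd]
  rw [hm] at hD hT₂ ⊢
  generalize (if K ≤ b then (1 : ℝ) else 0) = e at *
  generalize ((M : ℝ) - b) / (1 + b) = d at *
  have hKL : (K : ℝ) * (L' - Lt)
      = (K.choose ψ : ℝ) * (M.choose b : ℝ) * (K - d * ψ * α) := by
    rw [hL', hLt, hC]
    linear_combination (-d * (M.choose b : ℝ) * α) * hE
  rw [hT₂, hKL, hT₁, hL', hC]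
  have hD' := hD.ne'
  have hA' := hA.ne'
  have hB' := hB.ne'
  rw [div_eq_div_iff (mul_ne_zero hA' hB') hD', add_mul, div_mul_cancel₀ _ hD']
  ring
end

section
/- Let K ≥ 1, M ≥ 1 and 1 ≤ b ≤ M be integers with b < K, set ψ = min{K,b} = b, L' = C(K,ψ)·C(M,b), and L̃ = C(M,b+1)·C(K−1,ψ−1) (i.e., α = 1). Then the first phase of the one-shot scheme already delivers each user's whole file, L̃ ≥ L', if and only if K ≤ b·δ_MAN(b/M), where δ_MAN(μ) = M(1−μ)/(1+μM). -/
/-- With `b < K`, `ψ = b`, `L' = C(K,b)C(M,b)`, `L̃ = C(M,b+1)C(K-1,b-1)` (i.e. `α = 1`),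
the first phase already delivers each user's whole file, `L̃ ≥ L'`, iff
`K ≤ b·δ_MAN(b/M)`. -/
theorem stmt16 (K M b : ℕ) (hK : 1 ≤ K) (hM : 1 ≤ M) (hb1 : 1 ≤ b) (hbM : b ≤ M)
    (hbK : b < K)
    (L' Lt : ℝ)
    (hL' : L' = (K.choose b : ℝ) * (M.choose b : ℝ))
    (hLt : Lt = (M.choose (b + 1) : ℝ) * ((K - 1).choose (b - 1) : ℝ)) :
    L' ≤ Lt ↔ (K : ℝ) ≤ (b : ℝ) * deltaMAN M ((b : ℝ) / M) := by
  obtain ⟨k, rfl⟩ : ∃ k, K = k + 1 := ⟨K - 1, by omega⟩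
  obtain ⟨c, rfl⟩ : ∃ c, b = c + 1 := ⟨b - 1, by omega⟩
  simp only [Nat.add_sub_cancel] at hLt
  have hx : (0 : ℝ) < (k.choose c : ℝ) := by
    exact_mod_cast Nat.choose_pos (by omega)
  have hy : (0 : ℝ) < (M.choose (c + 1) : ℝ) := by
    exact_mod_cast Nat.choose_pos hbM
  have h1 : ((k : ℝ) + 1) * (k.choose c : ℝ) = ((k + 1).choose (c + 1) : ℝ) * ((c : ℝ) + 1) := by
    exact_mod_cast Nat.add_one_mul_choose_eq k c
  have h2 : (M.choose (c + 1 + 1) : ℝ) * ((c : ℝ) + 1 + 1)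
      = (M.choose (c + 1) : ℝ) * ((M : ℝ) - ((c : ℝ) + 1)) := by
    have h := Nat.choose_succ_right_eq M (c + 1)
    have h' : ((M.choose (c + 1 + 1) * (c + 1 + 1) : ℕ) : ℝ)
        = ((M.choose (c + 1) * (M - (c + 1)) : ℕ) : ℝ) := by rw [← h]
    rw [Nat.cast_mul, Nat.cast_mul, Nat.cast_sub hbM] at h'
    push_cast at h'
    exact h'
  have hM0 : (0 : ℝ) < M := by exact_mod_cast hM
  have hc : (0 : ℝ) < (c : ℝ) + 1 := by positivity
  have hc2 : (0 : ℝ) < (c : ℝ) + 1 + 1 := by positivity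
  have hd : deltaMAN M (((c + 1 : ℕ) : ℝ) / M) = ((M : ℝ) - ((c : ℝ) + 1)) / ((c : ℝ) + 1 + 1) := by
    unfold deltaMAN
    push_cast
    rw [div_mul_cancel₀ _ hM0.ne', mul_sub, mul_div_cancel₀ _ hM0.ne', mul_one,
      add_comm (1 : ℝ) ((c : ℝ) + 1)]
  have e1 : L' = ((k : ℝ) + 1) * ((k.choose c : ℝ) * (M.choose (c + 1) : ℝ) / ((c : ℝ) + 1)) := by
    rw [hL']
    field_simp
    linear_combination -h1
  have e2 : Lt = (((c : ℝ) + 1) * (((M : ℝ) - ((c : ℝ) + 1)) / ((c : ℝ) + 1 + 1)))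
      * ((k.choose c : ℝ) * (M.choose (c + 1) : ℝ) / ((c : ℝ) + 1)) := by
    have : (M.choose (c + 1 + 1) : ℝ)
        = (M.choose (c + 1) : ℝ) * ((M : ℝ) - ((c : ℝ) + 1)) / ((c : ℝ) + 1 + 1) := by
      rw [eq_div_iff hc2.ne', h2]
    rw [hLt, this]
    field_simp
  rw [hd, e1, e2]
  push_cast
  exact mul_le_mul_iff_left₀ (by positivity)
end
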